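/- Under the smoothness and convexity assumptions, let (x_k, y_k, v_k) be generated by sl-BAMM with averaging parameters satisfying 0 < μ_{k+1} ≤ μ_k ≤ 1/2, μ_k ≤ 2μ_{k+1}, and step sizes β_k ≤ 2/(σ_{ψμ_k} + L_{ψμ_k}), η_k ≤ 1/L_{ψμ_k}. Let (a_k), (b_k), (c_k) be decreasing sequences of positive reals and define the Lyapunov function V_k := a_k[Φ_{μ_k}(x_k) − F_0] + b_k ‖y_k − y*_{μ_k}(x_k)‖² + c_k ‖v_k − v*_{μ_k}(x_k)‖². Then V_{k+1} − V_k ≤ −(a_{k+1}α_k/2)‖∇Φ_{μ_k}(x_k)‖² − (α̂_k/2)‖x_{k+1}−x_k‖² − (β̂_k/2)‖y_k − y*_{μ_k}(x_k)‖² − (η̂_k/2)‖v_k − v*_{μ_k}(x_k)‖² + (2‖∇_y F(x_{k+1}, y*_{μ_{k+1}}(x_{k+1}))‖² a_{k+1}/σ_F)((μ_k−μ_{k+1})/μ_k) + (24‖∇_y F(x_{k+1}, y*_{μ_{k+1}}(x_{k+1}))‖² b_{k+1}/(σ_F² β_k σ_{ψμ_k}))((μ_k−μ_{k+1})/μ_k)²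 + (6(C_{v1}‖v*_{μ_{k+1}}(x_{k+1})‖ + C_{v2})² ‖∇_y F(x_{k+1}, y*_{μ_{k+1}}(x_{k+1}))‖² c_{k+1}/(η_k σ_{ψμ_k}))((μ_k−μ_{k+1})/μ_k²)², where α̂_k := a_{k+1}/α_k − a_{k+1}(C_{Φ1}‖v*_{μ_k}(x_k)‖ + C_{Φ2})/σ_{ψμ_k}² − 12L_{ψy1}² b_{k+1}/(β_k σ_{ψμ_k}³) − 12(L_{v1}‖v*_{μ_k}(x_k)‖ + L_{v2})² c_{k+1}/(η_k σ_{ψμ_k}⁵); β̂_k := b_{k+1}β_k σ_{ψμ_k} − 2a_{k+1}α_k(L_{ψxy2}‖v*_{μ_k}(x_k)‖ + L_{Fx2})² − 6(L_{ψyy2}‖v*_{μ_k}(x_k)‖ + L_{Fy2})² c_{k+1}η_k/σ_{ψμ_k}; η̂_k := c_{k+1}η_k σ_{ψμ_k} − 2a_{k+1}α_k L_{ψy1}². -/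

import Mathlib

open Set Filter Asymptotics
open scoped NNReal

noncomputable section

/-- `ℝⁿ` as a Euclidean space. -/
abbrev Eu (n : ℕ) : Type := EuclideanSpace ℝ (Fin n)

variable {n m : ℕ}

/-- Partial gradient with respect to the first (upper-level) variable. -/
def gradx (F : Eu n → Eu m → ℝ) (x : Eu n) (y : Eu m) : Eu n :=
  gradient (fun x' => F x' y) x

/-- Partial gradient with respect to the second (lower-level) variable. -/
def grady (F : Eu n → Eu m → ℝ) (x : Eu n) (y : Eu m) : Eu m :=
  gradient (fun y' => F x y') y

/-- Second-order partial derivative `∇²_{yy}`. -/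
def hessyy (F : Eu n → Eu m → ℝ) (x : Eu n) (y : Eu m) : Eu m →L[ℝ] Eu m :=
  fderiv ℝ (fun y' => grady F x y') y

/-- Mixed second-order partial derivative `∇²_{xy}`, viewed as the linear map
sending a multiplier `v ∈ ℝᵐ` to an element of `ℝⁿ`. -/
def hessxy (F : Eu n → Eu m → ℝ) (x : Eu n) (y : Eu m) : Eu m →L[ℝ] Eu n :=
  ContinuousLinearMap.adjoint (fderiv ℝ (fun x' => grady F x' y) x)

/-- The aggregation function `ψ_μ = μ F + (1-μ) f`. -/
def aggreg (μ : ℝ) (F f : Eu n → Eu m → ℝ) : Eu n → Eu m → ℝ :=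
  fun x y => μ * F x y + (1 - μ) * f x y

/-- The squared KKT residual of the equality-constrained reformulation
`min F(x,y) s.t. ∇_y f(x,y) = 0`. -/
def KKTres (F f : Eu n → Eu m → ℝ) (x : Eu n) (y v : Eu m) : ℝ :=
  ‖gradx F x y - hessxy f x y v‖ ^ 2 + ‖grady F x y - hessyy f x y v‖ ^ 2 +
    ‖grady f x y‖ ^ 2

open scoped RealInnerProductSpace Topology

section Partials

variable {E₁ E₂ G : Type*} [NormedAddCommGroup E₁] [NormedSpace ℝ E₁] [NormedAddCommGroup E₂]
  [NormedSpace ℝ E₂] [NormedAddCommGroup G] [NormedSpace ℝ G]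

/-- The derivative of a function of two variables, in terms of its partial derivatives. -/
lemma hasFDerivAt_uncurry_of_partials {H : E₁ → E₂ → G} {x : E₁} {y : E₂}
    (h : DifferentiableAt ℝ (Function.uncurry H) (x, y)) :
    HasFDerivAt (Function.uncurry H)
      ((fderiv ℝ (fun x' => H x' y) x).coprod (fderiv ℝ (H x) y)) (x, y) := by
  have h₁ : HasFDerivAt (fun x' => H x' y)
      ((fderiv ℝ (Function.uncurry H) (x, y)).comp (ContinuousLinearMap.inl ℝ E₁ E₂)) x :=
    HasFDerivAt.comp (f := fun x' => (x', y)) x h.hasFDerivAt (hasFDerivAt_prodMk_left x y)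
  have h₂ : HasFDerivAt (H x)
      ((fderiv ℝ (Function.uncurry H) (x, y)).comp (ContinuousLinearMap.inr ℝ E₁ E₂)) y :=
    h.hasFDerivAt.comp y (hasFDerivAt_prodMk_right x y)
  rw [h₁.fderiv, h₂.fderiv]
  convert h.hasFDerivAt using 1
  ext u <;> simp

end Partials

section Gradients

variable {F : Eu n → Eu m → ℝ}

lemma differentiable_right (hF : ContDiff ℝ 2 (Function.uncurry F)) (x : Eu n) :
    Differentiable ℝ (F x) := fun y =>
  ((hF.differentiable (by norm_num)) (x, y)).comp y (hasFDerivAt_prodMk_right x y).differentiableAt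

lemma differentiable_left (hF : ContDiff ℝ 2 (Function.uncurry F)) (y : Eu m) :
    Differentiable ℝ (fun x => F x y) := fun x =>
  DifferentiableAt.comp (f := fun x' => (x', y)) x ((hF.differentiable (by norm_num)) (x, y))
    (hasFDerivAt_prodMk_left x y).differentiableAt

lemma fderiv_right_apply (hF : ContDiff ℝ 2 (Function.uncurry F)) (x : Eu n) (y w : Eu m) :
    fderiv ℝ (F x) y w = ⟪grady F x y, w⟫ := by
  have h := (differentiable_right hF x y).hasGradientAt.hasFDerivAt
  rw [h.fderiv]
  rfl

lemma fderiv_left_apply (hF : ContDiff ℝ 2 (Function.uncurry F)) (x u : Eu n) (y : Eu m) :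
    fderiv ℝ (fun x' => F x' y) x u = ⟪gradx F x y, u⟫ := by
  have h := (differentiable_left hF y x).hasGradientAt.hasFDerivAt
  rw [h.fderiv]
  rfl

lemma contDiff_grady (hF : ContDiff ℝ 2 (Function.uncurry F)) :
    ContDiff ℝ 1 (Function.uncurry (grady F)) := by
  have h : Function.uncurry (grady F) = fun p : Eu n × Eu m =>
      (InnerProductSpace.toDual ℝ (Eu m)).symm
        ((fderiv ℝ (Function.uncurry F) p).comp (ContinuousLinearMap.inr ℝ (Eu n) (Eu m))) := by
    ext1 ⟨x, y⟩
    have h₂ : HasFDerivAt (F x) ((fderiv ℝ (Function.uncurry F) (x, y)).comp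
        (ContinuousLinearMap.inr ℝ (Eu n) (Eu m))) y :=
      ((hF.differentiable (by norm_num)) (x, y)).hasFDerivAt.comp y
        (hasFDerivAt_prodMk_right x y)
    simp only [Function.uncurry_apply_pair, grady, gradient]
    rw [← h₂.fderiv]
  rw [h]
  exact (InnerProductSpace.toDual ℝ (Eu m)).symm.contDiff.comp
    ((hF.fderiv_right (m := 1) (by norm_num)).clm_comp contDiff_const)

lemma hasFDerivAt_grady_right (hF : ContDiff ℝ 2 (Function.uncurry F)) (x : Eu n) (y : Eu m) :
    HasFDerivAt (grady F x) (hessyy F x y) y :=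
  DifferentiableAt.hasFDerivAt <|
    (((contDiff_grady hF).differentiable (by norm_num)) (x, y)).comp y
      (hasFDerivAt_prodMk_right x y).differentiableAt

lemma hasFDerivAt_grady_left (hF : ContDiff ℝ 2 (Function.uncurry F)) (x : Eu n) (y : Eu m) :
    HasFDerivAt (fun x' => grady F x' y) (fderiv ℝ (fun x' => grady F x' y) x) x :=
  DifferentiableAt.hasFDerivAt <|
    DifferentiableAt.comp (f := fun x' => (x', y)) x
      (((contDiff_grady hF).differentiable (by norm_num)) (x, y))
      (hasFDerivAt_prodMk_left x y).differentiableAt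

/-- `∇²_{yy}F` is symmetric. -/
lemma inner_hessyy_comm (hF : ContDiff ℝ 2 (Function.uncurry F)) (x : Eu n) (y u w : Eu m) :
    ⟪hessyy F x y u, w⟫ = ⟪u, hessyy F x y w⟫ := by
  have hc : ContDiff ℝ 2 (F x) := hF.comp (contDiff_prodMk_right x)
  have hsymm : IsSymmSndFDerivAt ℝ (F x) y :=
    hc.contDiffAt.isSymmSndFDerivAt (by simp)
  have key : ∀ u w, fderiv ℝ (fderiv ℝ (F x)) y u w = ⟪hessyy F x y u, w⟫ := by
    intro u w
    have h : fderiv ℝ (F x) = fun y' => InnerProductSpace.toDual ℝ (Eu m) (grady F x y') := by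
      ext y' w
      rw [fderiv_right_apply hF]
      rfl
    have h' : HasFDerivAt (fderiv ℝ (F x))
        ((InnerProductSpace.toDual ℝ (Eu m)).toContinuousLinearEquiv.toContinuousLinearMap.comp
          (hessyy F x y)) y := by
      rw [h]
      exact ((InnerProductSpace.toDual ℝ (Eu m)).toContinuousLinearEquiv
        |>.toContinuousLinearMap.hasFDerivAt).comp y (hasFDerivAt_grady_right hF x y)
    rw [h'.fderiv]
    rfl
  rw [← key, hsymm u w, key, real_inner_comm]

end Gradients

section SymmetricOperators

variable {E : Type*} [NormedAddCommGroup E] [InnerProductSpace ℝ E]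

/-- A symmetric operator is bounded by its numerical radius. -/
lemma norm_apply_le_of_symmetric {S : E →L[ℝ] E} (hS : ∀ u w, ⟪S u, w⟫ = ⟪u, S w⟫) {M : ℝ}
    (hM : ∀ w, |⟪S w, w⟫| ≤ M * ‖w‖ ^ 2) (u : E) : ‖S u‖ ≤ M * ‖u‖ := by
  have key : ∀ w, 4 * ⟪S u, w⟫ ≤ M * (2 * ‖u‖ ^ 2 + 2 * ‖w‖ ^ 2) := by
    intro w
    have h₁ := (abs_le.1 (hM (u + w))).2
    have h₂ := (abs_le.1 (hM (u - w))).1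
    have h₃ : ⟪S (u + w), u + w⟫ - ⟪S (u - w), u - w⟫ = 4 * ⟪S u, w⟫ := by
      have : ⟪S w, u⟫ = ⟪S u, w⟫ := by rw [hS, real_inner_comm]
      simp only [map_add, map_sub, inner_add_left, inner_add_right, inner_sub_left,
        inner_sub_right, this]
      ring
    have h₄ := congrArg (M * ·) (parallelogram_law_with_norm ℝ u w)
    linarith
  rcases eq_or_ne (S u) 0 with h0 | h0
  · rcases eq_or_ne u 0 with rfl | hu
    · simp
    · have hu' : 0 < ‖u‖ := norm_pos_iff.2 hu
      have := hM u
      rw [h0, inner_zero_left, abs_zero] at this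
      have hM0 : 0 ≤ M := nonneg_of_mul_nonneg_left this (by positivity)
      rw [h0, norm_zero]
      positivity
  · have hs : 0 < ‖S u‖ := norm_pos_iff.2 h0
    have h := key ((‖u‖ / ‖S u‖) • S u)
    rw [inner_smul_right, real_inner_self_eq_norm_sq, norm_smul, Real.norm_of_nonneg (by positivity),
      div_mul_cancel₀ _ hs.ne'] at h
    have h₅ : ‖u‖ / ‖S u‖ * ‖S u‖ ^ 2 = ‖u‖ * ‖S u‖ := by field_simp
    rw [h₅] at h
    have hu : 0 < ‖u‖ := norm_pos_iff.2 fun hu => h0 (by simp [hu])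
    have : ‖u‖ * ‖S u‖ ≤ ‖u‖ * (M * ‖u‖) := by linarith
    exact le_of_mul_le_mul_left this hu

/-- The gradient step `1 - t H` contracts by `1 - t σ` if `σ ≤ H ≤ L` and `t (σ + L) ≤ 2`. -/
lemma norm_sub_smul_apply_le {H : E →L[ℝ] E} (hH : ∀ u w, ⟪H u, w⟫ = ⟪u, H w⟫) {σ L t : ℝ}
    (hσ : ∀ w, σ * ‖w‖ ^ 2 ≤ ⟪H w, w⟫) (hL : ∀ w, ⟪H w, w⟫ ≤ L * ‖w‖ ^ 2) (ht : 0 ≤ t)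
    (htL : t * (σ + L) ≤ 2) (u : E) : ‖u - t • H u‖ ≤ (1 - t * σ) * ‖u‖ := by
  refine norm_apply_le_of_symmetric (S := ContinuousLinearMap.id ℝ E - t • H) ?_ ?_ u
  · intro u w
    simp [inner_sub_left, inner_sub_right, inner_smul_left, inner_smul_right, hH]
  · intro w
    have h : ⟪(ContinuousLinearMap.id ℝ E - t • H) w, w⟫ = ‖w‖ ^ 2 - t * ⟪H w, w⟫ := by
      simp [inner_sub_left, inner_smul_left]
    rw [h, abs_le]
    have h₁ := mul_le_mul_of_nonneg_left (hσ w) ht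
    have h₂ := mul_le_mul_of_nonneg_left (hL w) ht
    have h₃ := mul_le_mul_of_nonneg_right htL (sq_nonneg ‖w‖)
    constructor <;> nlinarith

lemma apply_inverse_of_coercive [FiniteDimensional ℝ E] {H : E →L[ℝ] E} {σ : ℝ} (hσ : 0 < σ)
    (hH : ∀ w, σ * ‖w‖ ^ 2 ≤ ⟪H w, w⟫) (g : E) : H (H.inverse g) = g := by
  have hinj : Function.Injective H.toLinearMap := by
    rw [injective_iff_map_eq_zero]
    intro w hw
    have h := hH w
    change H w = 0 at hw
    rw [hw, inner_zero_left] at h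
    by_contra hne
    have : 0 < ‖w‖ := norm_pos_iff.2 hne
    have : 0 < σ * ‖w‖ ^ 2 := by positivity
    linarith
  have hinv : H.IsInvertible :=
    ⟨(LinearEquiv.ofInjectiveEndo H.toLinearMap hinj).toContinuousLinearEquiv, by ext; rfl⟩
  exact hinv.self_apply_inverse g

lemma norm_le_of_coercive {H : E →L[ℝ] E} {σ : ℝ} (hH : ∀ w, σ * ‖w‖ ^ 2 ≤ ⟪H w, w⟫) (w : E) :
    σ * ‖w‖ ≤ ‖H w‖ := by
  rcases eq_or_ne w 0 with rfl | hw
  · simp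
  · have h := (hH w).trans (real_inner_le_norm _ _)
    exact le_of_mul_le_mul_right (by nlinarith) (norm_pos_iff.2 hw)

end SymmetricOperators

section Convexity

variable {E : Type*} [NormedAddCommGroup E] [InnerProductSpace ℝ E]

/-- The first-order lower bound for strongly convex functions. -/
lemma StrongConvexOn.fderiv_apply_le {g : E → ℝ} {σ : ℝ} (hg : StrongConvexOn univ σ g) {y : E}
    (hd : DifferentiableAt ℝ g y) (z : E) :
    fderiv ℝ g y (z - y) + σ / 2 * ‖z - y‖ ^ 2 ≤ g z - g y := by
  have hlim : Tendsto (fun t : ℝ => t⁻¹ • (g (y + t • (z - y)) - g y)) (𝓝[>] 0)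
      (𝓝 (fderiv ℝ g y (z - y))) :=
    (hd.hasFDerivAt.hasLineDerivAt (z - y)).tendsto_slope_zero_right
  have hlim' : Tendsto (fun t : ℝ => g z - g y - (1 - t) * (σ / 2 * ‖z - y‖ ^ 2)) (𝓝[>] 0)
      (𝓝 (g z - g y - (1 - 0) * (σ / 2 * ‖z - y‖ ^ 2))) := by
    refine Tendsto.mono_left (Continuous.tendsto ?_ 0) nhdsWithin_le_nhds
    fun_prop
  have h := le_of_tendsto_of_tendsto hlim hlim' ?_
  · linarith
  · filter_upwards [Ioc_mem_nhdsGT (zero_lt_one' ℝ)] with t ht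
    have h := hg.2 (mem_univ y) (mem_univ z) (sub_nonneg.2 ht.2) ht.1.le (by ring)
    have he : (1 - t) • y + t • z = y + t • (z - y) := by module
    rw [he, norm_sub_rev] at h
    simp only [smul_eq_mul] at h ⊢
    rw [inv_mul_le_iff₀ ht.1]
    linarith

end Convexity

/-- A function of two variables that is Lipschitz in each of them separately. -/
structure PartialLipschitz {G : Type*} [NormedAddCommGroup G] (H : Eu n → Eu m → G)
    (L₁ L₂ : ℝ) : Prop where
  nonneg_left : 0 ≤ L₁
  nonneg_right : 0 ≤ L₂
  left : ∀ x x' y, ‖H x y - H x' y‖ ≤ L₁ * ‖x - x'‖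
  right : ∀ x y y', ‖H x y - H x y'‖ ≤ L₂ * ‖y - y'‖

namespace PartialLipschitz

variable {G : Type*} [NormedAddCommGroup G] {H K : Eu n → Eu m → G} {L₁ L₂ M₁ M₂ : ℝ}

lemma of_lipschitzWith {L₁ L₂ : ℝ≥0} (h₁ : ∀ y, LipschitzWith L₁ fun x => H x y)
    (h₂ : ∀ x, LipschitzWith L₂ fun y => H x y) : PartialLipschitz H L₁ L₂ :=
  ⟨L₁.2, L₂.2, fun x x' y => (h₁ y).norm_sub_le x x', fun x y y' => (h₂ x).norm_sub_le y y'⟩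

lemma norm_sub_le (h : PartialLipschitz H L₁ L₂) (x x' : Eu n) (y y' : Eu m) :
    ‖H x y - H x' y'‖ ≤ L₁ * ‖x - x'‖ + L₂ * ‖y - y'‖ :=
  (norm_sub_le_norm_sub_add_norm_sub _ (H x' y) _).trans
    (add_le_add (h.left x x' y) (h.right x' y y'))

lemma average [NormedSpace ℝ G] (hH : PartialLipschitz H L₁ L₂) (hK : PartialLipschitz K M₁ M₂)
    {μ : ℝ} (h₀ : 0 ≤ μ) (h₁ : μ ≤ 1) :
    PartialLipschitz (fun x y => μ • H x y + (1 - μ) • K x y)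
      (μ * L₁ + (1 - μ) * M₁) (μ * L₂ + (1 - μ) * M₂) := by
  have h₁' : 0 ≤ 1 - μ := sub_nonneg.2 h₁
  have key : ∀ (p p' q q' : G) (A B r : ℝ), ‖p - p'‖ ≤ A * r → ‖q - q'‖ ≤ B * r →
      ‖μ • p + (1 - μ) • q - (μ • p' + (1 - μ) • q')‖ ≤ (μ * A + (1 - μ) * B) * r := by
    intro p p' q q' A B r hp hq
    have : μ • p + (1 - μ) • q - (μ • p' + (1 - μ) • q') = μ • (p - p') + (1 - μ) • (q - q') := by
      module
    rw [this]
    refine (norm_add_le _ _).trans ?_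
    rw [norm_smul, norm_smul, Real.norm_of_nonneg h₀, Real.norm_of_nonneg h₁']
    linarith [mul_le_mul_of_nonneg_left hp h₀, mul_le_mul_of_nonneg_left hq h₁']
  have hL := hH.nonneg_left
  have hL' := hH.nonneg_right
  have hM := hK.nonneg_left
  have hM' := hK.nonneg_right
  exact ⟨by positivity, by positivity,
    fun x x' y => key _ _ _ _ _ _ _ (hH.left x x' y) (hK.left x x' y),
    fun x y y' => key _ _ _ _ _ _ _ (hH.right x y y') (hK.right x y y')⟩

end PartialLipschitz

section Aggregation

variable {F f : Eu n → Eu m → ℝ}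

lemma contDiff_aggreg (hF : ContDiff ℝ 2 (Function.uncurry F))
    (hf : ContDiff ℝ 2 (Function.uncurry f)) (μ : ℝ) :
    ContDiff ℝ 2 (Function.uncurry (aggreg μ F f)) :=
  (contDiff_const.mul hF).add (contDiff_const.mul hf)

lemma grady_aggreg (hF : ContDiff ℝ 2 (Function.uncurry F))
    (hf : ContDiff ℝ 2 (Function.uncurry f)) (μ : ℝ) :
    grady (aggreg μ F f) = fun x y => μ • grady F x y + (1 - μ) • grady f x y := by
  ext1 x
  ext1 y
  refine ext_inner_right ℝ fun w => ?_
  rw [← fderiv_right_apply (contDiff_aggreg hF hf μ), inner_add_left, inner_smul_left,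
    inner_smul_left, ← fderiv_right_apply hF, ← fderiv_right_apply hf]
  have h : HasFDerivAt (aggreg μ F f x) (μ • fderiv ℝ (F x) y + (1 - μ) • fderiv ℝ (f x) y) y :=
    ((differentiable_right hF x y).hasFDerivAt.const_mul μ).add
      ((differentiable_right hf x y).hasFDerivAt.const_mul (1 - μ))
  rw [h.fderiv]
  simp

lemma hessyy_aggreg (hF : ContDiff ℝ 2 (Function.uncurry F))
    (hf : ContDiff ℝ 2 (Function.uncurry f)) (μ : ℝ) :
    hessyy (aggreg μ F f) = fun x y => μ • hessyy F x y + (1 - μ) • hessyy f x y := by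
  ext1 x
  ext1 y
  rw [hessyy, grady_aggreg hF hf]
  exact (((hasFDerivAt_grady_right hF x y).const_smul μ).add
    ((hasFDerivAt_grady_right hf x y).const_smul (1 - μ))).fderiv

lemma hessxy_aggreg (hF : ContDiff ℝ 2 (Function.uncurry F))
    (hf : ContDiff ℝ 2 (Function.uncurry f)) (μ : ℝ) :
    hessxy (aggreg μ F f) = fun x y => μ • hessxy F x y + (1 - μ) • hessxy f x y := by
  ext1 x
  ext1 y
  have h := (((hasFDerivAt_grady_left hF x y).const_smul μ).add
    ((hasFDerivAt_grady_left hf x y).const_smul (1 - μ))).fderiv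
  rw [hessxy, grady_aggreg hF hf]
  refine (congrArg ContinuousLinearMap.adjoint h).trans ?_
  rw [map_add, map_smulₛₗ, map_smulₛₗ]
  rfl

lemma strongConvexOn_aggreg {σ : ℝ} {x : Eu n} (hF : StrongConvexOn univ σ (F x))
    (hf : ConvexOn ℝ univ (f x)) {μ : ℝ} (h₀ : 0 ≤ μ) (h₁ : μ ≤ 1) :
    StrongConvexOn univ (μ * σ) (aggreg μ F f x) := by
  refine ⟨convex_univ, fun y hy z hz s t hs ht hst => ?_⟩
  have h := mul_le_mul_of_nonneg_left (hF.2 hy hz hs ht hst) h₀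
  have h' := mul_le_mul_of_nonneg_left (hf.2 hy hz hs ht hst) (sub_nonneg.2 h₁)
  simp only [aggreg, smul_eq_mul] at h h' ⊢
  linarith

end Aggregation

section StronglyConvex

variable {ψ : Eu n → Eu m → ℝ} {σ L₁ L₂ : ℝ}

lemma norm_hessyy_le (hL : PartialLipschitz (grady ψ) L₁ L₂) (x : Eu n) (y : Eu m) :
    ‖hessyy ψ x y‖ ≤ L₂ :=
  norm_fderiv_le_of_lip' ℝ hL.nonneg_right (Eventually.of_forall fun y' => hL.right x y' y)

lemma norm_hessxy_le (hL : PartialLipschitz (grady ψ) L₁ L₂) (x : Eu n) (y : Eu m) :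
    ‖hessxy ψ x y‖ ≤ L₁ := by
  rw [hessxy, LinearIsometryEquiv.norm_map]
  exact norm_fderiv_le_of_lip' ℝ hL.nonneg_left (Eventually.of_forall fun x' => hL.left x' x y)

lemma inner_grady_sub_ge (hψ : ContDiff ℝ 2 (Function.uncurry ψ))
    (hsc : ∀ x, StrongConvexOn univ σ (ψ x)) (x : Eu n) (y z : Eu m) :
    σ * ‖y - z‖ ^ 2 ≤ ⟪grady ψ x y - grady ψ x z, y - z⟫ := by
  have h₁ := (hsc x).fderiv_apply_le (differentiable_right hψ x y) z
  have h₂ := (hsc x).fderiv_apply_le (differentiable_right hψ x z) y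
  rw [fderiv_right_apply hψ] at h₁ h₂
  rw [← neg_sub y z, inner_neg_right, norm_neg] at h₁
  rw [inner_sub_left]
  linarith

lemma norm_sub_le_norm_grady_sub (hψ : ContDiff ℝ 2 (Function.uncurry ψ))
    (hsc : ∀ x, StrongConvexOn univ σ (ψ x)) (x : Eu n) (y z : Eu m) :
    σ * ‖y - z‖ ≤ ‖grady ψ x y - grady ψ x z‖ := by
  rcases eq_or_ne (y - z) 0 with h0 | h0
  · simp [h0]
  · have h := (inner_grady_sub_ge hψ hsc x y z).trans (real_inner_le_norm _ _)
    exact le_of_mul_le_mul_right (by nlinarith) (norm_pos_iff.2 h0)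

lemma inner_hessyy_ge (hψ : ContDiff ℝ 2 (Function.uncurry ψ))
    (hsc : ∀ x, StrongConvexOn univ σ (ψ x)) (x : Eu n) (y w : Eu m) :
    σ * ‖w‖ ^ 2 ≤ ⟪hessyy ψ x y w, w⟫ := by
  have hlim : Tendsto (fun t : ℝ => ⟪t⁻¹ • (grady ψ x (y + t • w) - grady ψ x y), w⟫) (𝓝[>] 0)
      (𝓝 ⟪hessyy ψ x y w, w⟫) :=
    (((hasFDerivAt_grady_right hψ x y).hasLineDerivAt w).tendsto_slope_zero_right).inner
      tendsto_const_nhds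
  refine ge_of_tendsto hlim ?_
  filter_upwards [self_mem_nhdsWithin] with t (ht : 0 < t)
  have h := inner_grady_sub_ge hψ hsc x (y + t • w) y
  rw [add_sub_cancel_left, norm_smul, inner_smul_right, Real.norm_of_nonneg ht.le] at h
  rw [real_inner_smul_left, le_inv_mul_iff₀ ht]
  exact le_of_mul_le_mul_left (by linarith) ht

lemma inner_hessyy_le (hL : PartialLipschitz (grady ψ) L₁ L₂) (x : Eu n) (y w : Eu m) :
    ⟪hessyy ψ x y w, w⟫ ≤ L₂ * ‖w‖ ^ 2 := by
  have h := (hessyy ψ x y).le_of_opNorm_le (norm_hessyy_le hL x y) w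
  nlinarith [real_inner_le_norm (hessyy ψ x y w) w, norm_nonneg w]

/-- A strongly convex function on a nontrivial space has `σ ≤ L`. -/
lemma strongConvex_le_lipschitz [Nontrivial (Eu m)] (hψ : ContDiff ℝ 2 (Function.uncurry ψ))
    (hL : PartialLipschitz (grady ψ) L₁ L₂) (hsc : ∀ x, StrongConvexOn univ σ (ψ x)) : σ ≤ L₂ := by
  obtain ⟨w, hw⟩ := exists_ne (0 : Eu m)
  have h := (inner_hessyy_ge hψ hsc 0 0 w).trans (inner_hessyy_le hL 0 0 w)
  have : 0 < ‖w‖ := norm_pos_iff.2 hw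
  exact le_of_mul_le_mul_right h (by positivity)

lemma norm_sub_smul_hessyy_le (hψ : ContDiff ℝ 2 (Function.uncurry ψ))
    (hL : PartialLipschitz (grady ψ) L₁ L₂) (hsc : ∀ x, StrongConvexOn univ σ (ψ x)) {t : ℝ}
    (ht : 0 ≤ t) (htL : t * (σ + L₂) ≤ 2) (x : Eu n) (y w : Eu m) :
    ‖w - t • hessyy ψ x y w‖ ≤ (1 - t * σ) * ‖w‖ :=
  norm_sub_smul_apply_le (inner_hessyy_comm hψ x y) (inner_hessyy_ge hψ hsc x y)
    (inner_hessyy_le hL x y) ht htL w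

lemma norm_gradient_step_sub_le [Nontrivial (Eu m)] (hψ : ContDiff ℝ 2 (Function.uncurry ψ))
    (hL : PartialLipschitz (grady ψ) L₁ L₂) (hsc : ∀ x, StrongConvexOn univ σ (ψ x)) {t : ℝ}
    (ht : 0 ≤ t) (htL : t * (σ + L₂) ≤ 2) (x : Eu n) {y z : Eu m} (hz : grady ψ x z = 0) :
    ‖y - t • grady ψ x y - z‖ ≤ (1 - t * σ) * ‖y - z‖ := by
  have hd : ∀ y, HasFDerivAt (fun y => y - t • grady ψ x y)
      (ContinuousLinearMap.id ℝ (Eu m) - t • hessyy ψ x y) y := fun y =>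
    (hasFDerivAt_id y).sub ((hasFDerivAt_grady_right hψ x y).const_smul t)
  have h0 : 0 ≤ 1 - t * σ := by
    obtain ⟨w, hw⟩ := exists_ne (0 : Eu m)
    have := (norm_nonneg _).trans (norm_sub_smul_hessyy_le hψ hL hsc ht htL 0 0 w)
    exact nonneg_of_mul_nonneg_left this (norm_pos_iff.2 hw)
  have h := Convex.norm_image_sub_le_of_norm_hasFDerivWithin_le (s := univ) (x := z) (y := y)
    (C := 1 - t * σ) (fun y _ => (hd y).hasFDerivWithinAt)
    (fun y _ => ContinuousLinearMap.opNorm_le_bound _ h0 fun w =>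
      norm_sub_smul_hessyy_le hψ hL hsc ht htL x y w) convex_univ (mem_univ _) (mem_univ _)
  simpa [hz] using h

end StronglyConvex

section Descent

variable {E : Type*} [NormedAddCommGroup E] [InnerProductSpace ℝ E] [CompleteSpace E]

/-- The descent lemma, for a gradient that is Lipschitz relative to the base point. -/
lemma le_of_gradient_lipschitz_at {Φ : E → ℝ} {g : E → E} (hΦ : ∀ x, HasGradientAt Φ (g x) x)
    {x : E} {L : ℝ} (hL : ∀ x', ‖g x' - g x‖ ≤ L * ‖x' - x‖) (z : E) :
    Φ z ≤ Φ x + ⟪g x, z - x⟫ + L / 2 * ‖z - x‖ ^ 2 := by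
  set d := z - x with hd
  let h : ℝ → ℝ := fun t => Φ (x + t • d) - t * ⟪g x, d⟫ - L / 2 * ‖d‖ ^ 2 * t ^ 2
  have hder : ∀ t, HasDerivAt h (⟪g (x + t • d), d⟫ - ⟪g x, d⟫ - L * ‖d‖ ^ 2 * t) t := by
    intro t
    have h₁ : HasDerivAt (fun t : ℝ => x + t • d) d t := by
      simpa using ((hasDerivAt_id t).smul_const d).const_add x
    have h₂ : HasDerivAt (fun t : ℝ => Φ (x + t • d)) ⟪g (x + t • d), d⟫ t :=
      HasFDerivAt.comp_hasDerivAt (f := fun t : ℝ => x + t • d) t (hΦ (x + t • d)).hasFDerivAt h₁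
    have h₃ := (h₂.sub ((hasDerivAt_id t).mul_const ⟪g x, d⟫)).sub
      (((hasDerivAt_id t).pow 2).const_mul (L / 2 * ‖d‖ ^ 2))
    refine h₃.congr_deriv ?_
    simp
    ring
  have hanti : AntitoneOn h (Icc 0 1) := by
    refine antitoneOn_of_deriv_nonpos (convex_Icc 0 1)
      (fun t _ => (hder t).continuousAt.continuousWithinAt)
      (fun t _ => (hder t).differentiableAt.differentiableWithinAt) fun t ht => ?_
    rw [interior_Icc] at ht
    rw [(hder t).deriv, ← inner_sub_left]
    have h₁ := hL (x + t • d)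
    rw [add_sub_cancel_left, norm_smul, Real.norm_of_nonneg ht.1.le] at h₁
    nlinarith [real_inner_le_norm (g (x + t • d) - g x) d, norm_nonneg d]
  have h01 := hanti (left_mem_Icc.2 zero_le_one) (right_mem_Icc.2 zero_le_one) zero_le_one
  simp only [h, hd, one_smul, zero_smul, add_sub_cancel, add_zero] at h01
  linarith

/-- Descent along an inexact gradient step. -/
lemma inexact_gradient_step_le {Φ : E → ℝ} {g : E → E} (hΦ : ∀ x, HasGradientAt Φ (g x) x)
    {x d : E} {L α : ℝ} (hα : 0 < α) (hL : ∀ x', ‖g x' - g x‖ ≤ L * ‖x' - x‖) :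
    Φ (x - α • d) ≤ Φ x - α / 2 * ‖g x‖ ^ 2 - (1 / α - L) / 2 * ‖x - α • d - x‖ ^ 2 +
      α / 2 * ‖g x - d‖ ^ 2 := by
  have h := le_of_gradient_lipschitz_at hΦ hL (x - α • d)
  have h₁ : x - α • d - x = -(α • d) := by abel
  have h₂ : 1 / α * (α * ‖d‖) ^ 2 = α * ‖d‖ ^ 2 := by field_simp
  rw [h₁, inner_neg_right, inner_smul_right, norm_neg, norm_smul, Real.norm_of_nonneg hα.le] at h
  rw [h₁, norm_neg, norm_smul, Real.norm_of_nonneg hα.le, norm_sub_sq_real]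
  linarith

end Descent

lemma norm_sub_le_of_coercive {E : Type*} [NormedAddCommGroup E] [InnerProductSpace ℝ E]
    {A A' : E →L[ℝ] E} {σ : ℝ} (hA' : ∀ w, σ * ‖w‖ ^ 2 ≤ ⟪A' w, w⟫) {v v' g g' : E}
    (hv : A v = g) (hv' : A' v' = g') : σ * ‖v' - v‖ ≤ ‖g' - g‖ + ‖(A' - A) v‖ := by
  have h := norm_le_of_coercive hA' (v' - v)
  have : A' (v' - v) = g' - g - (A' - A) v := by
    rw [map_sub, hv', sub_apply, hv]
    abel
  rw [this] at h
  exact h.trans (norm_sub_le _ _)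

section SolutionMap

variable {F ψ : Eu n → Eu m → ℝ} {σ Lx1 Lx2 Ly1 Ly2 L₁ L₂ Lxy1 Lxy2 Lyy1 Lyy2 : ℝ}
  {s w : Eu n → Eu m}

lemma norm_solution_sub_le (hψ : ContDiff ℝ 2 (Function.uncurry ψ))
    (hL : PartialLipschitz (grady ψ) L₁ L₂) (hσ : 0 < σ)
    (hsc : ∀ x, StrongConvexOn univ σ (ψ x)) (hs : ∀ x, grady ψ x (s x) = 0) (x x' : Eu n) :
    ‖s x' - s x‖ ≤ L₁ / σ * ‖x' - x‖ := by
  have h := norm_sub_le_norm_grady_sub hψ hsc x' (s x') (s x)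
  have h' := hL.left x x' (s x)
  rw [hs, zero_sub, norm_neg] at h
  rw [hs, zero_sub, norm_neg, norm_sub_rev] at h'
  rw [div_mul_eq_mul_div, le_div_iff₀ hσ]
  linarith

lemma norm_multiplier_sub_le (hψ : ContDiff ℝ 2 (Function.uncurry ψ))
    (hL : PartialLipschitz (grady ψ) L₁ L₂) (hyy : PartialLipschitz (hessyy ψ) Lyy1 Lyy2)
    (hFy : PartialLipschitz (grady F) Ly1 Ly2) (hσ : 0 < σ)
    (hsc : ∀ x, StrongConvexOn univ σ (ψ x)) (hs : ∀ x, grady ψ x (s x) = 0)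
    (hw : ∀ x, hessyy ψ x (s x) (w x) = grady F x (s x)) (x x' : Eu n) :
    ‖w x' - w x‖ ≤ ((Lyy2 * L₁ + Lyy1 * σ) * ‖w x‖ + (Ly2 * L₁ + Ly1 * σ)) / σ ^ 2 *
      ‖x' - x‖ := by
  have h := norm_sub_le_of_coercive (inner_hessyy_ge hψ hsc x' (s x')) (hw x) (hw x')
  have h₁ := hFy.norm_sub_le x' x (s x') (s x)
  have h₂ := ContinuousLinearMap.le_of_opNorm_le _ (hyy.norm_sub_le x' x (s x') (s x)) (w x)
  have hs' := norm_solution_sub_le hψ hL hσ hsc hs x x'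
  have h₃ := mul_le_mul_of_nonneg_left hs' hFy.nonneg_right
  have h₄ := mul_le_mul_of_nonneg_left hs' hyy.nonneg_right
  have h₅ := mul_le_mul_of_nonneg_right h₄ (norm_nonneg (w x))
  have h₆ : σ * ‖w x' - w x‖ ≤ σ * (((Lyy2 * L₁ + Lyy1 * σ) * ‖w x‖ + (Ly2 * L₁ + Ly1 * σ)) /
      σ ^ 2 * ‖x' - x‖) := by
    have : σ * (((Lyy2 * L₁ + Lyy1 * σ) * ‖w x‖ + (Ly2 * L₁ + Ly1 * σ)) / σ ^ 2 * ‖x' - x‖) =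
        Ly1 * ‖x' - x‖ + Ly2 * (L₁ / σ * ‖x' - x‖) +
          (Lyy1 * ‖x' - x‖ + Lyy2 * (L₁ / σ * ‖x' - x‖)) * ‖w x‖ := by
      field_simp
      ring
    rw [this]
    linarith
  exact le_of_mul_le_mul_left h₆ hσ

/-- The gradient of the value function `x ↦ F(x, s(x))` of the lower-level solution map `s`. -/
lemma hasGradientAt_value (hF : ContDiff ℝ 2 (Function.uncurry F))
    (hψ : ContDiff ℝ 2 (Function.uncurry ψ))
    (hL : PartialLipschitz (grady ψ) L₁ L₂) (hσ : 0 < σ)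
    (hsc : ∀ x, StrongConvexOn univ σ (ψ x)) (hs : ∀ x, grady ψ x (s x) = 0)
    (hw : ∀ x, hessyy ψ x (s x) (w x) = grady F x (s x)) (x : Eu n) :
    HasGradientAt (fun x' => F x' (s x')) (gradx F x (s x) - hessxy ψ x (s x) (w x)) x := by
  -- `F - ⟪w x, ∇_y ψ⟫` has vanishing `y`-derivative at `(x, s x)` and is `F` on the graph of `s`.
  have hP := (hasFDerivAt_uncurry_of_partials
      ((hF.differentiable (by norm_num)) (x, s x))).sub
    ((innerSL ℝ (w x)).hasFDerivAt.comp (x, s x)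
      (hasFDerivAt_uncurry_of_partials (((contDiff_grady hψ).differentiable (by norm_num))
        (x, s x))))
  have hcont : Tendsto (fun x' => (x', s x')) (𝓝 x) (𝓝 (x, s x)) := by
    refine tendsto_id.prodMk_nhds ?_
    rw [tendsto_iff_norm_sub_tendsto_zero]
    refine squeeze_zero (fun _ => norm_nonneg _)
      (fun x' => norm_solution_sub_le hψ hL hσ hsc hs x x') ?_
    have : Continuous fun x' => L₁ / σ * ‖x' - x‖ := by fun_prop
    simpa using this.tendsto x
  have hbig : (fun x' => ((x', s x') : Eu n × Eu m) - (x, s x)) =O[𝓝 x] fun x' => x' - x := by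
    refine IsBigO.of_bound (max 1 (L₁ / σ)) (Eventually.of_forall fun x' => ?_)
    have h := norm_solution_sub_le hψ hL hσ hsc hs x x'
    rw [Prod.mk_sub_mk, Prod.norm_mk, max_mul_of_nonneg _ _ (norm_nonneg _), one_mul]
    exact max_le_max le_rfl h
  have ho := (hP.isLittleO.comp_tendsto hcont).trans_isBigO hbig
  rw [hasGradientAt_iff_isLittleO]
  refine ho.congr_left fun x' => ?_
  have hg₁ := fderiv_left_apply hF x (x' - x) (s x)
  have hg₂ := fderiv_right_apply hF x (s x) (s x' - s x)
  have hg₃ : ⟪w x, fderiv ℝ (grady ψ x) (s x) (s x' - s x)⟫ = ⟪grady F x (s x), s x' - s x⟫ := by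
    rw [← hw x]
    exact (inner_hessyy_comm hψ x (s x) _ _).symm
  have hg₄ : ⟪w x, fderiv ℝ (fun x' => grady ψ x' (s x)) x (x' - x)⟫ =
      ⟪hessxy ψ x (s x) (w x), x' - x⟫ := by
    rw [hessxy, ContinuousLinearMap.adjoint_inner_left]
  simp [-map_sub, hs, hg₁, hg₂, hg₃, hg₄, inner_sub_left, inner_add_right]

lemma norm_hypergradient_sub_le (hψ : ContDiff ℝ 2 (Function.uncurry ψ))
    (hL : PartialLipschitz (grady ψ) L₁ L₂) (hxy : PartialLipschitz (hessxy ψ) Lxy1 Lxy2)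
    (hyy : PartialLipschitz (hessyy ψ) Lyy1 Lyy2) (hFx : PartialLipschitz (gradx F) Lx1 Lx2)
    (hFy : PartialLipschitz (grady F) Ly1 Ly2) (hσ : 0 < σ)
    (hsc : ∀ x, StrongConvexOn univ σ (ψ x)) (hs : ∀ x, grady ψ x (s x) = 0)
    (hw : ∀ x, hessyy ψ x (s x) (w x) = grady F x (s x)) (x x' : Eu n) :
    ‖(gradx F x' (s x') - hessxy ψ x' (s x') (w x')) -
        (gradx F x (s x) - hessxy ψ x (s x) (w x))‖ ≤
      ((L₁ ^ 2 * Lyy2 + L₁ * (Lyy1 + Lxy2) * σ + Lxy1 * σ ^ 2) * ‖w x‖ +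
        (L₁ ^ 2 * Ly2 + L₁ * (Ly1 + Lx2) * σ + Lx1 * σ ^ 2)) / σ ^ 2 * ‖x' - x‖ := by
  have heq : (gradx F x' (s x') - hessxy ψ x' (s x') (w x')) -
      (gradx F x (s x) - hessxy ψ x (s x) (w x)) = (gradx F x' (s x') - gradx F x (s x)) -
      (hessxy ψ x' (s x') - hessxy ψ x (s x)) (w x) - hessxy ψ x' (s x') (w x' - w x) := by
    rw [map_sub, sub_apply]
    abel
  have h₁ := hFx.norm_sub_le x' x (s x') (s x)
  have h₂ := ContinuousLinearMap.le_of_opNorm_le _ (hxy.norm_sub_le x' x (s x') (s x)) (w x)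
  have h₃ := ContinuousLinearMap.le_of_opNorm_le _ (norm_hessxy_le hL x' (s x')) (w x' - w x)
  have h₄ := mul_le_mul_of_nonneg_left
    (norm_multiplier_sub_le hψ hL hyy hFy hσ hsc hs hw x x') hL.nonneg_left
  have hs' := norm_solution_sub_le hψ hL hσ hsc hs x x'
  have h₅ := mul_le_mul_of_nonneg_left hs' hFx.nonneg_right
  have h₆ := mul_le_mul_of_nonneg_right (mul_le_mul_of_nonneg_left hs' hxy.nonneg_right)
    (norm_nonneg (w x))
  have hfin : ((L₁ ^ 2 * Lyy2 + L₁ * (Lyy1 + Lxy2) * σ + Lxy1 * σ ^ 2) * ‖w x‖ +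
        (L₁ ^ 2 * Ly2 + L₁ * (Ly1 + Lx2) * σ + Lx1 * σ ^ 2)) / σ ^ 2 * ‖x' - x‖ =
      Lx1 * ‖x' - x‖ + Lx2 * (L₁ / σ * ‖x' - x‖) +
      (Lxy1 * ‖x' - x‖ + Lxy2 * (L₁ / σ * ‖x' - x‖)) * ‖w x‖ +
      L₁ * (((Lyy2 * L₁ + Lyy1 * σ) * ‖w x‖ + (Ly2 * L₁ + Ly1 * σ)) / σ ^ 2 * ‖x' - x‖) := by
    field_simp
    ring
  rw [heq, hfin]
  refine (norm_sub_le _ _).trans ((add_le_add_left (norm_sub_le _ _) _).trans ?_)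
  linarith

/-- The error of the inexact hypergradient at `(y, v)`. -/
lemma norm_hypergradient_error_le (hL : PartialLipschitz (grady ψ) L₁ L₂)
    (hxy : PartialLipschitz (hessxy ψ) Lxy1 Lxy2) (hFx : PartialLipschitz (gradx F) Lx1 Lx2)
    (x : Eu n) (y z v u : Eu m) :
    ‖(gradx F x z - hessxy ψ x z u) - (gradx F x y - hessxy ψ x y v)‖ ≤
      (Lxy2 * ‖u‖ + Lx2) * ‖y - z‖ + L₁ * ‖v - u‖ := by
  have heq : (gradx F x z - hessxy ψ x z u) - (gradx F x y - hessxy ψ x y v) =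
      (gradx F x z - gradx F x y) - (hessxy ψ x z - hessxy ψ x y) u + hessxy ψ x y (v - u) := by
    rw [map_sub, sub_apply]
    abel
  have h₁ := hFx.right x z y
  have h₂ := ContinuousLinearMap.le_of_opNorm_le _ (hxy.right x z y) u
  have h₃ := ContinuousLinearMap.le_of_opNorm_le _ (norm_hessxy_le hL x y) (v - u)
  rw [norm_sub_rev z y] at h₁ h₂
  rw [heq]
  refine (norm_add_le _ _).trans ((add_le_add_left (norm_sub_le _ _) _).trans ?_)
  linarith

/-- One step of the linear-system iteration. -/
lemma norm_multiplier_step_sub_le (hψ : ContDiff ℝ 2 (Function.uncurry ψ))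
    (hL : PartialLipschitz (grady ψ) L₁ L₂) (hyy : PartialLipschitz (hessyy ψ) Lyy1 Lyy2)
    (hFy : PartialLipschitz (grady F) Ly1 Ly2) (hsc : ∀ x, StrongConvexOn univ σ (ψ x)) {t : ℝ}
    (ht : 0 ≤ t) (htL : t * (σ + L₂) ≤ 2) (x : Eu n) {y z v u : Eu m}
    (hu : hessyy ψ x z u = grady F x z) :
    ‖v + t • (grady F x y - hessyy ψ x y v) - u‖ ≤
      (1 - t * σ) * ‖v - u‖ + t * ((Lyy2 * ‖u‖ + Ly2) * ‖y - z‖) := by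
  have heq : v + t • (grady F x y - hessyy ψ x y v) - u =
      ((v - u) - t • hessyy ψ x y (v - u)) +
        t • ((grady F x y - grady F x z) - (hessyy ψ x y - hessyy ψ x z) u) := by
    rw [map_sub, sub_apply, hu]
    module
  have h₁ := norm_sub_smul_hessyy_le hψ hL hsc ht htL x y (v - u)
  have h₂ := hFy.right x y z
  have h₃ := ContinuousLinearMap.le_of_opNorm_le _ (hyy.right x y z) u
  rw [heq]
  refine (norm_add_le _ _).trans (add_le_add h₁ ?_)
  rw [norm_smul, Real.norm_of_nonneg ht]
  refine mul_le_mul_of_nonneg_left ((norm_sub_le _ _).trans ?_) ht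
  linarith

end SolutionMap

section ParameterDependence

variable {F f : Eu n → Eu m → ℝ} {σF LF1 LF2 Lf1 Lf2 LFyy1 LFyy2 Lfyy1 Lfyy2 μ μ' : ℝ}

/-- Dependence of the lower-level solution on the averaging parameter. -/
lemma norm_solution_sub_le_of_parameter (hF : ContDiff ℝ 2 (Function.uncurry F))
    (hf : ContDiff ℝ 2 (Function.uncurry f)) (hσF : 0 < σF)
    (hFsc : ∀ x, StrongConvexOn univ σF (F x)) (hfconv : ∀ x, ConvexOn ℝ univ (f x))
    (hμ' : 0 < μ') (hle : μ' ≤ μ) (hμ : μ ≤ 1 / 2) {x : Eu n} {y y' : Eu m}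
    (hy : grady (aggreg μ F f) x y = 0) (hy' : grady (aggreg μ' F f) x y' = 0) :
    ‖y - y'‖ ≤ 2 * ‖grady F x y'‖ / σF * ((μ - μ') / μ) := by
  have hμ0 : 0 < μ := hμ'.trans_le hle
  have h := norm_sub_le_norm_grady_sub (contDiff_aggreg hF hf μ)
    (fun x => strongConvexOn_aggreg (hFsc x) (hfconv x) hμ0.le (by linarith)) x y y'
  rw [hy, zero_sub, norm_neg] at h
  rw [grady_aggreg hF hf] at hy' h
  simp only at hy' h
  have h1 : 0 < 1 - μ' := by linarith
  have heq : μ • grady F x y' + (1 - μ) • grady f x y' =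
      ((μ - μ') / (1 - μ')) • grady F x y' := by
    have hf' : (1 - μ') • grady f x y' = -(μ' • grady F x y') := by
      rw [eq_neg_iff_add_eq_zero, add_comm, hy']
    have hf'' : grady f x y' = -((μ' / (1 - μ')) • grady F x y') := by
      rw [← inv_smul_smul₀ h1.ne' (grady f x y'), hf', smul_neg, smul_smul, inv_mul_eq_div]
    rw [hf'', smul_neg, smul_smul, ← sub_eq_add_neg, ← sub_smul]
    congr 1
    field_simp
    ring
  rw [heq, norm_smul, Real.norm_of_nonneg (div_nonneg (sub_nonneg.2 hle) h1.le)] at h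
  have h2 : (μ - μ') / (1 - μ') ≤ 2 * (μ - μ') := by
    rw [div_le_iff₀ h1]
    nlinarith
  have h3 := h.trans (mul_le_mul_of_nonneg_right h2 (norm_nonneg _))
  have h4 : 2 * ‖grady F x y'‖ / σF * ((μ - μ') / μ) =
      2 * (μ - μ') * ‖grady F x y'‖ / (μ * σF) := by
    field_simp
  rw [h4, le_div_iff₀ (by positivity)]
  linarith

lemma value_sub_le_of_parameter (hF : ContDiff ℝ 2 (Function.uncurry F))
    (hf : ContDiff ℝ 2 (Function.uncurry f)) (hσF : 0 < σF)
    (hFsc : ∀ x, StrongConvexOn univ σF (F x)) (hfconv : ∀ x, ConvexOn ℝ univ (f x))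
    (hμ' : 0 < μ') (hle : μ' ≤ μ) (hμ : μ ≤ 1 / 2) {x : Eu n} {y y' : Eu m}
    (hy : grady (aggreg μ F f) x y = 0) (hy' : grady (aggreg μ' F f) x y' = 0) :
    F x y' - F x y ≤ 2 * ‖grady F x y'‖ ^ 2 / σF * ((μ - μ') / μ) := by
  have h := norm_solution_sub_le_of_parameter hF hf hσF hFsc hfconv hμ' hle hμ hy hy'
  have h₁ := (hFsc x).fderiv_apply_le (differentiable_right hF x y') y
  rw [fderiv_right_apply hF] at h₁
  have h₂ := (abs_le.1 (abs_real_inner_le_norm (grady F x y') (y - y'))).1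
  have h₃ := mul_le_mul_of_nonneg_left h (norm_nonneg (grady F x y'))
  have h₄ : 0 ≤ σF / 2 * ‖y - y'‖ ^ 2 := by positivity
  have h₅ : 2 * ‖grady F x y'‖ ^ 2 / σF * ((μ - μ') / μ) =
      ‖grady F x y'‖ * (2 * ‖grady F x y'‖ / σF * ((μ - μ') / μ)) := by ring
  linarith

/-- Dependence of the multiplier on the averaging parameter. -/
lemma norm_multiplier_sub_le_of_parameter (hF : ContDiff ℝ 2 (Function.uncurry F))
    (hf : ContDiff ℝ 2 (Function.uncurry f)) (hFy : PartialLipschitz (grady F) LF1 LF2)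
    (hfy : PartialLipschitz (grady f) Lf1 Lf2) (hFyy : PartialLipschitz (hessyy F) LFyy1 LFyy2)
    (hfyy : PartialLipschitz (hessyy f) Lfyy1 Lfyy2) (hσF : 0 < σF)
    (hFsc : ∀ x, StrongConvexOn univ σF (F x)) (hfconv : ∀ x, ConvexOn ℝ univ (f x))
    (hμ' : 0 < μ') (hle : μ' ≤ μ) (hμ : μ ≤ 1 / 2) (hμ2 : μ ≤ 2 * μ') {x : Eu n}
    {y y' v v' : Eu m}
    (hy : grady (aggreg μ F f) x y = 0) (hy' : grady (aggreg μ' F f) x y' = 0)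
    (hv : hessyy (aggreg μ F f) x y v = grady F x y)
    (hv' : hessyy (aggreg μ' F f) x y' v' = grady F x y') :
    ‖v - v'‖ ≤ (2 * (LFyy2 + Lfyy2) / σF ^ 2 * ‖v'‖ + 2 * (2 * LF2 + Lf2) / σF ^ 2) *
      ‖grady F x y'‖ * ((μ - μ') / μ ^ 2) := by
  have hμ0 : 0 < μ := hμ'.trans_le hle
  have hsub : 0 ≤ μ - μ' := sub_nonneg.2 hle
  have hyd := norm_solution_sub_le_of_parameter hF hf hσF hFsc hfconv hμ' hle hμ hy hy'
  set D := 2 * ‖grady F x y'‖ / σF * ((μ - μ') / μ) with hD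
  have hcoer := inner_hessyy_ge (contDiff_aggreg hF hf μ)
    (fun x => strongConvexOn_aggreg (hFsc x) (hfconv x) hμ0.le (by linarith)) x y
  have hcoer' := inner_hessyy_ge (contDiff_aggreg hF hf μ')
    (fun x => strongConvexOn_aggreg (hFsc x) (hfconv x) hμ'.le (by linarith)) x y'
  have h := norm_sub_le_of_coercive hcoer hv' hv
  have hv'_norm := norm_le_of_coercive hcoer' v'
  rw [hv'] at hv'_norm
  have heq : hessyy (aggreg μ F f) x y - hessyy (aggreg μ' F f) x y' =
      (hessyy (aggreg μ F f) x y - hessyy (aggreg μ F f) x y') +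
        (μ - μ') • (hessyy F x y' - hessyy f x y') := by
    rw [hessyy_aggreg hF hf, hessyy_aggreg hF hf]
    module
  have hyy := hFyy.average hfyy hμ0.le (by linarith : μ ≤ 1)
  rw [← hessyy_aggreg hF hf μ] at hyy
  have h₁ : ‖grady F x y - grady F x y'‖ ≤ LF2 * D :=
    (hFy.right x y y').trans (mul_le_mul_of_nonneg_left hyd hFy.nonneg_right)
  have h₂ : ‖(hessyy (aggreg μ F f) x y - hessyy (aggreg μ F f) x y') v'‖ ≤
      (LFyy2 + Lfyy2) * D * ‖v'‖ := by
    refine ContinuousLinearMap.le_of_opNorm_le _ ((hyy.right x y y').trans ?_) _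
    refine mul_le_mul ?_ hyd (norm_nonneg _) (add_nonneg hFyy.nonneg_right hfyy.nonneg_right)
    nlinarith [hFyy.nonneg_right, hfyy.nonneg_right]
  have h₃ : ‖((μ - μ') • (hessyy F x y' - hessyy f x y')) v'‖ ≤
      (μ - μ') * (LF2 + Lf2) * ‖v'‖ := by
    refine ContinuousLinearMap.le_of_opNorm_le _ ?_ _
    rw [norm_smul, Real.norm_of_nonneg hsub]
    exact mul_le_mul_of_nonneg_left ((norm_sub_le _ _).trans
      (add_le_add (norm_hessyy_le hFy x y') (norm_hessyy_le hfy x y'))) hsub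
  have h₄ : ‖v'‖ ≤ 2 * ‖grady F x y'‖ / (μ * σF) := by
    rw [le_div_iff₀ (by positivity)]
    have := mul_le_mul_of_nonneg_right hμ2 (mul_nonneg hσF.le (norm_nonneg v'))
    linarith
  have h₅ := mul_le_mul_of_nonneg_left h₄
    (mul_nonneg hsub (add_nonneg hFy.nonneg_right hfy.nonneg_right))
  rw [heq, add_apply] at h
  have h₆ := norm_add_le ((hessyy (aggreg μ F f) x y - hessyy (aggreg μ F f) x y') v')
    (((μ - μ') • (hessyy F x y' - hessyy f x y')) v')
  have hfin : μ * σF * ((2 * (LFyy2 + Lfyy2) / σF ^ 2 * ‖v'‖ + 2 * (2 * LF2 + Lf2) / σF ^ 2) *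
      ‖grady F x y'‖ * ((μ - μ') / μ ^ 2)) = LF2 * D + (LFyy2 + Lfyy2) * D * ‖v'‖ +
        (μ - μ') * (LF2 + Lf2) * (2 * ‖grady F x y'‖ / (μ * σF)) := by
    rw [hD]
    field_simp
    ring
  refine le_of_mul_le_mul_left ?_ (mul_pos hμ0 hσF)
  rw [hfin]
  linarith

end ParameterDependence

/-- A contraction by `1 - t`, perturbed by `e` and followed by a drift of size `B₁ + B₂`. -/
lemma sq_le_of_contraction_of_drift {t q e B₁ B₂ N : ℝ} (ht : 0 < t) (ht1 : t ≤ 1) (hN : 0 ≤ N)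
    (h : N ≤ (1 - t) * q + e + (B₁ + B₂)) :
    N ^ 2 ≤ (1 - t / 2) * q ^ 2 + 3 * e ^ 2 / t + 6 * B₁ ^ 2 / t + 6 * B₂ ^ 2 / t := by
  obtain ⟨e, rfl⟩ : ∃ e', e = t * e' := ⟨e / t, by field_simp⟩
  obtain ⟨B₁, rfl⟩ : ∃ e', B₁ = t * e' := ⟨B₁ / t, by field_simp⟩
  obtain ⟨B₂, rfl⟩ : ∃ e', B₂ = t * e' := ⟨B₂ / t, by field_simp⟩
  have key : ∀ c a : ℝ, c * (t * a) ^ 2 / t = c * t * a ^ 2 := by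
    intro c a
    field_simp
  simp only [key]
  have h₁ : N ^ 2 ≤ ((1 - t) * q + t * e + (t * B₁ + t * B₂)) ^ 2 := pow_le_pow_left₀ hN h 2
  set u := (1 - t) * q + t * e with hu
  have h₂ : u ^ 2 ≤ (1 - t) * q ^ 2 + t * e ^ 2 := by
    have : 0 ≤ t * (1 - t) * (q - e) ^ 2 :=
      mul_nonneg (mul_nonneg ht.le (sub_nonneg.2 ht1)) (sq_nonneg _)
    rw [hu]
    linarith
  have h₃ : (u + (t * B₁ + t * B₂)) ^ 2 ≤
      (1 + t / 2) * u ^ 2 + 3 * t * (B₁ + B₂) ^ 2 := by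
    have h : 0 ≤ t / 2 * (u - 2 * (B₁ + B₂)) ^ 2 := by positivity
    have h' : 0 ≤ t * (1 - t) * (B₁ + B₂) ^ 2 :=
      mul_nonneg (mul_nonneg ht.le (sub_nonneg.2 ht1)) (sq_nonneg _)
    linarith
  have h₄ := mul_le_mul_of_nonneg_left h₂ (by positivity : 0 ≤ 1 + t / 2)
  have h₅ : 0 ≤ 3 * t * (B₁ - B₂) ^ 2 := by positivity
  have h₆ : 0 ≤ t ^ 2 / 2 * q ^ 2 := by positivity
  have h₇ : 0 ≤ t * (4 - t) / 2 * e ^ 2 :=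
    mul_nonneg (div_nonneg (mul_nonneg ht.le (by linarith)) two_pos.le) (sq_nonneg e)
  linarith

lemma grady_eq_zero_of_forall_le {ψ : Eu n → Eu m → ℝ} {x : Eu n} {y : Eu m}
    (h : ∀ y', ψ x y ≤ ψ x y') : grady ψ x y = 0 := by
  have h0 : fderiv ℝ (ψ x) y = 0 := IsLocalMin.fderiv_eq_zero (Eventually.of_forall h)
  rw [grady, gradient]
  exact (congrArg _ h0).trans (map_zero _)

section Assembly

/-- The scalar bookkeeping that combines the descent of the value function with the contraction of
the two tracking errors. -/
lemma lyapunov_sub_le {a a' b b' c c' α β η σ σF C L Lx Ly Lv Cv g G P Y Y' W W' δ ε F₀ F₁ F₂ Fm : ℝ}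
    (hη : 0 < η) (ha' : 0 ≤ a') (hb' : 0 ≤ b') (hc' : 0 ≤ c') (ha : a' ≤ a) (hb : b' ≤ b)
    (hc : c' ≤ c) (hFm : Fm ≤ F₀)
    (hF₁ : F₁ ≤ F₀ - α / 2 * g ^ 2 - (1 / α - C / σ ^ 2) / 2 * P ^ 2 +
      α * (Lx ^ 2 * Y ^ 2 + L ^ 2 * W ^ 2))
    (hF₂ : F₂ - F₁ ≤ 2 * G ^ 2 / σF * δ)
    (hY : Y' ^ 2 ≤ (1 - β * σ / 2) * Y ^ 2 + 6 * (L / σ * P) ^ 2 / (β * σ) +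
      6 * (2 * G / σF * δ) ^ 2 / (β * σ))
    (hW : W' ^ 2 ≤ (1 - η * σ / 2) * W ^ 2 + 3 * (η * (Ly * Y)) ^ 2 / (η * σ) +
      6 * (Lv / σ ^ 2 * P) ^ 2 / (η * σ) + 6 * (Cv * G * ε) ^ 2 / (η * σ)) :
    a' * (F₂ - Fm) + b' * Y' ^ 2 + c' * W' ^ 2 - (a * (F₀ - Fm) + b * Y ^ 2 + c * W ^ 2) ≤
      -(a' * α / 2) * g ^ 2
      - ((a' / α - a' * C / σ ^ 2 - 12 * L ^ 2 * b' / (β * σ ^ 3)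
          - 12 * Lv ^ 2 * c' / (η * σ ^ 5)) / 2) * P ^ 2
      - ((b' * β * σ - 2 * a' * α * Lx ^ 2 - 6 * Ly ^ 2 * c' * η / σ) / 2) * Y ^ 2
      - ((c' * η * σ - 2 * a' * α * L ^ 2) / 2) * W ^ 2
      + (2 * G ^ 2 * a' / σF) * δ
      + (24 * G ^ 2 * b' / (σF ^ 2 * β * σ)) * δ ^ 2
      + (6 * Cv ^ 2 * G ^ 2 * c' / (η * σ)) * ε ^ 2 := by
  have hcancel : 3 * (η * (Ly * Y)) ^ 2 / (η * σ) = 3 * Ly ^ 2 * η / σ * Y ^ 2 := by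
    field_simp
  rw [hcancel] at hW
  have hA := mul_le_mul_of_nonneg_left (add_le_add hF₁ hF₂) ha'
  have hB := mul_le_mul_of_nonneg_left hY hb'
  have hC := mul_le_mul_of_nonneg_left hW hc'
  have hA' := mul_le_mul_of_nonneg_right ha (sub_nonneg.2 hFm)
  have hB' := mul_le_mul_of_nonneg_right hb (sq_nonneg Y)
  have hC' := mul_le_mul_of_nonneg_right hc (sq_nonneg W)
  ring_nf at hA hB hC hA' hB' hC' ⊢
  linarith

end Assembly

/-- Lemma D.7: descent of the Lyapunov function
`V_k = a_k (Φ_{μ_k}(x_k) − F₀) + b_k ‖y_k − y*_{μ_k}(x_k)‖² + c_k ‖v_k − v*_{μ_k}(x_k)‖²`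
along the sl-BAMM iterates. -/
theorem lyapunov_descent {n m : ℕ}
    (F f : Eu n → Eu m → ℝ)
    (hF : ContDiff ℝ 2 (Function.uncurry F))
    (hf : ContDiff ℝ 2 (Function.uncurry f))
    (LFx1 LFx2 LFy1 LFy2 Lfy1 Lfy2 LFxy1 LFxy2 Lfxy1 Lfxy2 LFyy1 LFyy2 Lfyy1 Lfyy2 : ℝ≥0)
    (hLFx1 : ∀ y, LipschitzWith LFx1 fun x => gradx F x y)
    (hLFx2 : ∀ x, LipschitzWith LFx2 fun y => gradx F x y)
    (hLFy1 : ∀ y, LipschitzWith LFy1 fun x => grady F x y)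
    (hLFy2 : ∀ x, LipschitzWith LFy2 fun y => grady F x y)
    (hLfy1 : ∀ y, LipschitzWith Lfy1 fun x => grady f x y)
    (hLfy2 : ∀ x, LipschitzWith Lfy2 fun y => grady f x y)
    (hLFxy1 : ∀ y, LipschitzWith LFxy1 fun x => hessxy F x y)
    (hLFxy2 : ∀ x, LipschitzWith LFxy2 fun y => hessxy F x y)
    (hLfxy1 : ∀ y, LipschitzWith Lfxy1 fun x => hessxy f x y)
    (hLfxy2 : ∀ x, LipschitzWith Lfxy2 fun y => hessxy f x y)
    (hLFyy1 : ∀ y, LipschitzWith LFyy1 fun x => hessyy F x y)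
    (hLFyy2 : ∀ x, LipschitzWith LFyy2 fun y => hessyy F x y)
    (hLfyy1 : ∀ y, LipschitzWith Lfyy1 fun x => hessyy f x y)
    (hLfyy2 : ∀ x, LipschitzWith Lfyy2 fun y => hessyy f x y)
    (σF : ℝ) (hσF : 0 < σF)
    (hFsc : ∀ x, StrongConvexOn univ σF (F x))
    (hfconv : ∀ x, ConvexOn ℝ univ (f x))
    (F0 : ℝ) (hF0 : ∀ x y, F0 ≤ F x y)
    (ystar : ℝ → Eu n → Eu m)
    (hmin : ∀ μ' ∈ Ioc (0 : ℝ) 1, ∀ x y,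
      aggreg μ' F f x (ystar μ' x) ≤ aggreg μ' F f x y)
    (vstar : ℝ → Eu n → Eu m)
    (hvstar : ∀ μ' x, vstar μ' x =
      (hessyy (aggreg μ' F f) x (ystar μ' x)).inverse (grady F x (ystar μ' x)))
    -- the sl-BAMM iterates
    (μ α β η : ℕ → ℝ) (x : ℕ → Eu n) (y v : ℕ → Eu m)
    (hμpos : ∀ k, 0 < μ (k + 1)) (hμdec : ∀ k, μ (k + 1) ≤ μ k)
    (hμhalf : ∀ k, μ k ≤ 1 / 2) (hμ2 : ∀ k, μ k ≤ 2 * μ (k + 1))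
    (σψ Lψ Lψy1 Lψxy1 Lψxy2 Lψyy1 Lψyy2 Lv1 Lv2 CΦ1 CΦ2 : ℕ → ℝ) (Cv1 Cv2 : ℝ)
    (hσψ : ∀ k, σψ k = μ k * σF)
    (hLψ : ∀ k, Lψ k = μ k * LFy2 + (1 - μ k) * Lfy2)
    (hLψy1 : ∀ k, Lψy1 k = μ k * LFy1 + (1 - μ k) * Lfy1)
    (hLψxy1 : ∀ k, Lψxy1 k = μ k * LFxy1 + (1 - μ k) * Lfxy1)
    (hLψxy2 : ∀ k, Lψxy2 k = μ k * LFxy2 + (1 - μ k) * Lfxy2)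
    (hLψyy1 : ∀ k, Lψyy1 k = μ k * LFyy1 + (1 - μ k) * Lfyy1)
    (hLψyy2 : ∀ k, Lψyy2 k = μ k * LFyy2 + (1 - μ k) * Lfyy2)
    (hLv1 : ∀ k, Lv1 k = Lψyy2 k * Lψy1 k + Lψyy1 k * σψ k)
    (hLv2 : ∀ k, Lv2 k = LFy2 * Lψy1 k + LFy1 * σψ k)
    (hCΦ1 : ∀ k, CΦ1 k = Lψy1 k ^ 2 * Lψyy2 k +
      Lψy1 k * (Lψyy1 k + Lψxy2 k) * σψ k + Lψxy1 k * σψ k ^ 2)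
    (hCΦ2 : ∀ k, CΦ2 k = Lψy1 k ^ 2 * LFy2 +
      Lψy1 k * (LFy1 + LFx2) * σψ k + LFx1 * σψ k ^ 2)
    (hCv1 : Cv1 = 2 * (LFyy2 + Lfyy2) / σF ^ 2)
    (hCv2 : Cv2 = 2 * (2 * LFy2 + Lfy2) / σF ^ 2)
    (hαpos : ∀ k, 0 < α k) (hβpos : ∀ k, 0 < β k) (hηpos : ∀ k, 0 < η k)
    (hβ : ∀ k, β k ≤ 2 / (σψ k + Lψ k)) (hη : ∀ k, η k ≤ 1 / Lψ k)
    (hy : ∀ k, y (k + 1) = y k - β k • grady (aggreg (μ k) F f) (x k) (y k))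
    (hv : ∀ k, v (k + 1) = v k + η k •
      (grady F (x k) (y k) - hessyy (aggreg (μ k) F f) (x k) (y k) (v k)))
    (hx : ∀ k, x (k + 1) = x k - α k •
      (gradx F (x k) (y k) - hessxy (aggreg (μ k) F f) (x k) (y k) (v k)))
    -- the Lyapunov coefficients
    (a b c : ℕ → ℝ)
    (hapos : ∀ k, 0 < a k) (hbpos : ∀ k, 0 < b k) (hcpos : ∀ k, 0 < c k)
    (hadec : ∀ k, a (k + 1) ≤ a k) (hbdec : ∀ k, b (k + 1) ≤ b k)
    (hcdec : ∀ k, c (k + 1) ≤ c k)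
    (V αhat βhat ηhat : ℕ → ℝ)
    (hV : ∀ k, V k = a k * (F (x k) (ystar (μ k) (x k)) - F0) +
      b k * ‖y k - ystar (μ k) (x k)‖ ^ 2 +
      c k * ‖v k - vstar (μ k) (x k)‖ ^ 2)
    (hαhat : ∀ k, αhat k = a (k + 1) / α k
      - a (k + 1) * (CΦ1 k * ‖vstar (μ k) (x k)‖ + CΦ2 k) / σψ k ^ 2
      - 12 * Lψy1 k ^ 2 * b (k + 1) / (β k * σψ k ^ 3)
      - 12 * (Lv1 k * ‖vstar (μ k) (x k)‖ + Lv2 k) ^ 2 * c (k + 1) /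
          (η k * σψ k ^ 5))
    (hβhat : ∀ k, βhat k = b (k + 1) * β k * σψ k
      - 2 * a (k + 1) * α k * (Lψxy2 k * ‖vstar (μ k) (x k)‖ + LFx2) ^ 2
      - 6 * (Lψyy2 k * ‖vstar (μ k) (x k)‖ + LFy2) ^ 2 * c (k + 1) * η k / σψ k)
    (hηhat : ∀ k, ηhat k = c (k + 1) * η k * σψ k
      - 2 * a (k + 1) * α k * Lψy1 k ^ 2) :
    ∀ k, V (k + 1) - V k ≤
      -(a (k + 1) * α k / 2) *
          ‖gradient (fun x' => F x' (ystar (μ k) x')) (x k)‖ ^ 2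
      - (αhat k / 2) * ‖x (k + 1) - x k‖ ^ 2
      - (βhat k / 2) * ‖y k - ystar (μ k) (x k)‖ ^ 2
      - (ηhat k / 2) * ‖v k - vstar (μ k) (x k)‖ ^ 2
      + (2 * ‖grady F (x (k + 1)) (ystar (μ (k + 1)) (x (k + 1)))‖ ^ 2 *
          a (k + 1) / σF) * ((μ k - μ (k + 1)) / μ k)
      + (24 * ‖grady F (x (k + 1)) (ystar (μ (k + 1)) (x (k + 1)))‖ ^ 2 *
          b (k + 1) / (σF ^ 2 * β k * σψ k)) * ((μ k - μ (k + 1)) / μ k) ^ 2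
      + (6 * (Cv1 * ‖vstar (μ (k + 1)) (x (k + 1))‖ + Cv2) ^ 2 *
          ‖grady F (x (k + 1)) (ystar (μ (k + 1)) (x (k + 1)))‖ ^ 2 *
          c (k + 1) / (η k * σψ k)) * ((μ k - μ (k + 1)) / μ k ^ 2) ^ 2 := by
  intro k
  have hμmem : ∀ j, μ j ∈ Ioc (0 : ℝ) 1 := fun j =>
    ⟨(hμpos j).trans_le (hμdec j), (hμhalf j).trans (by norm_num)⟩
  have hFx := PartialLipschitz.of_lipschitzWith hLFx1 hLFx2
  have hFy := PartialLipschitz.of_lipschitzWith hLFy1 hLFy2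
  have hfy := PartialLipschitz.of_lipschitzWith hLfy1 hLfy2
  have hFyy := PartialLipschitz.of_lipschitzWith hLFyy1 hLFyy2
  have hfyy := PartialLipschitz.of_lipschitzWith hLfyy1 hLfyy2
  have hs : ∀ j x, grady (aggreg (μ j) F f) x (ystar (μ j) x) = 0 := fun j x =>
    grady_eq_zero_of_forall_le (hmin (μ j) (hμmem j) x)
  have hψsc : ∀ j x, StrongConvexOn univ (σψ j) (aggreg (μ j) F f x) := fun j x => by
    rw [hσψ]
    exact strongConvexOn_aggreg (hFsc x) (hfconv x) (hμmem j).1.le (hμmem j).2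
  have hσψpos : ∀ j, 0 < σψ j := fun j => by
    rw [hσψ]
    exact mul_pos (hμmem j).1 hσF
  have hψ : ∀ j, ContDiff ℝ 2 (Function.uncurry (aggreg (μ j) F f)) := fun j =>
    contDiff_aggreg hF hf (μ j)
  have hw : ∀ j x, hessyy (aggreg (μ j) F f) x (ystar (μ j) x) (vstar (μ j) x) =
      grady F x (ystar (μ j) x) := fun j x => by
    rw [hvstar]
    exact apply_inverse_of_coercive (hσψpos j) (inner_hessyy_ge (hψ j) (hψsc j) x _) _
  have hψy := hFy.average hfy (hμmem k).1.le (hμmem k).2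
  rw [← grady_aggreg hF hf, ← hLψy1, ← hLψ] at hψy
  have hψyy := hFyy.average hfyy (hμmem k).1.le (hμmem k).2
  rw [← hessyy_aggreg hF hf, ← hLψyy1, ← hLψyy2] at hψyy
  have hψxy := (PartialLipschitz.of_lipschitzWith hLFxy1 hLFxy2).average
    (PartialLipschitz.of_lipschitzWith hLfxy1 hLfxy2) (hμmem k).1.le (hμmem k).2
  rw [← hessxy_aggreg hF hf, ← hLψxy1, ← hLψxy2] at hψxy
  have hσ := hσψpos k
  have ht₁ : 0 < β k * σψ k := mul_pos (hβpos k) hσ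
  have ht₂ : 0 < η k * σψ k := mul_pos (hηpos k) hσ
  have hgrad := hasGradientAt_value hF (hψ k) hψy hσ (hψsc k) (hs k) (hw k)
  rw [(hgrad (x k)).gradient]
  set x₀ := x k with hx₀
  set x₁ := x (k + 1) with hx₁
  set y₀ := ystar (μ k) x₀ with hy₀
  set v₀ := vstar (μ k) x₀ with hv₀
  set y₁ := ystar (μ (k + 1)) x₁ with hy₁
  set v₁ := vstar (μ (k + 1)) x₁ with hv₁
  set g := gradx F x₀ y₀ - hessxy (aggreg (μ k) F f) x₀ y₀ v₀ with hg
  -- the value function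
  have hΦ : F x₁ (ystar (μ k) x₁) ≤ F x₀ y₀ - α k / 2 * ‖g‖ ^ 2 -
      (1 / α k - (CΦ1 k * ‖v₀‖ + CΦ2 k) / σψ k ^ 2) / 2 * ‖x₁ - x₀‖ ^ 2 +
      α k * ((Lψxy2 k * ‖v₀‖ + LFx2) ^ 2 * ‖y k - y₀‖ ^ 2 +
        Lψy1 k ^ 2 * ‖v k - v₀‖ ^ 2) := by
    have h := inexact_gradient_step_le hgrad (x := x₀)
      (d := gradx F x₀ (y k) - hessxy (aggreg (μ k) F f) x₀ (y k) (v k)) (hαpos k)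
      (norm_hypergradient_sub_le (hψ k) hψy hψxy hψyy hFx hFy hσ (hψsc k) (hs k) (hw k) x₀)
    rw [← hx k, ← hx₁, ← hCΦ1, ← hCΦ2] at h
    have he := pow_le_pow_left₀ (norm_nonneg _)
      (norm_hypergradient_error_le hψy hψxy hFx x₀ (y k) y₀ (v k) v₀) 2
    have he' := mul_le_mul_of_nonneg_left (he.trans (add_sq_le)) (half_pos (hαpos k)).le
    linarith
  have hΦ' := value_sub_le_of_parameter hF hf hσF hFsc hfconv (hμpos k) (hμdec k) (hμhalf k)
    (hs k x₁) (hs (k + 1) x₁)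
  rw [← hy₁] at hΦ'
  -- the tracking errors
  have hydrift : ‖y₀ - y₁‖ ≤ Lψy1 k / σψ k * ‖x₁ - x₀‖ +
      2 * ‖grady F x₁ y₁‖ / σF * ((μ k - μ (k + 1)) / μ k) := by
    have h := norm_solution_sub_le (hψ k) hψy hσ (hψsc k) (hs k) x₀ x₁
    rw [norm_sub_rev] at h
    exact (norm_sub_le_norm_sub_add_norm_sub _ (ystar (μ k) x₁) _).trans (add_le_add h
      (norm_solution_sub_le_of_parameter hF hf hσF hFsc hfconv (hμpos k) (hμdec k) (hμhalf k)
        (hs k x₁) (hs (k + 1) x₁)))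
  have hvdrift : ‖v₀ - v₁‖ ≤ (Lv1 k * ‖v₀‖ + Lv2 k) / σψ k ^ 2 * ‖x₁ - x₀‖ +
      (Cv1 * ‖v₁‖ + Cv2) * ‖grady F x₁ y₁‖ * ((μ k - μ (k + 1)) / μ k ^ 2) := by
    have h := norm_multiplier_sub_le (hψ k) hψy hψyy hFy hσ (hψsc k) (hs k) (hw k) x₀ x₁
    rw [norm_sub_rev, ← hLv1, ← hLv2] at h
    have h' := norm_multiplier_sub_le_of_parameter hF hf hFy hfy hFyy hfyy hσF hFsc hfconv
      (hμpos k) (hμdec k) (hμhalf k) (hμ2 k) (hs k x₁) (hs (k + 1) x₁) (hw k x₁) (hw (k + 1) x₁)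
    rw [← hCv1, ← hCv2] at h'
    exact (norm_sub_le_norm_sub_add_norm_sub _ (vstar (μ k) x₁) _).trans (add_le_add h h')
  have hY : ‖y (k + 1) - y₁‖ ^ 2 ≤ (1 - β k * σψ k / 2) * ‖y k - y₀‖ ^ 2 +
      6 * (Lψy1 k / σψ k * ‖x₁ - x₀‖) ^ 2 / (β k * σψ k) +
      6 * (2 * ‖grady F x₁ y₁‖ / σF * ((μ k - μ (k + 1)) / μ k)) ^ 2 / (β k * σψ k) := by
    rcases subsingleton_or_nontrivial (Eu m) with hm | hm
    · rw [Subsingleton.elim (y (k + 1)) y₁, Subsingleton.elim (y k) y₀]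
      simp only [sub_self, norm_zero, ne_eq, OfNat.ofNat_ne_zero, not_false_eq_true, zero_pow,
        mul_zero, zero_add]
      positivity
    · have hσL := strongConvex_le_lipschitz (hψ k) hψy (hψsc k)
      have hβL : β k * (σψ k + Lψ k) ≤ 2 := (le_div_iff₀ (by linarith)).1 (hβ k)
      have ht : β k * σψ k ≤ 1 := by nlinarith [hβpos k]
      have h := norm_gradient_step_sub_le (hψ k) hψy (hψsc k) (hβpos k).le hβL x₀ (y := y k)
        (hs k x₀)
      rw [← hy k] at h
      have h' := sq_le_of_contraction_of_drift (e := 0) ht₁ ht (norm_nonneg _)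
        ((norm_sub_le_norm_sub_add_norm_sub (y (k + 1)) y₀ y₁).trans
          (add_le_add (h.trans (add_zero _).ge) hydrift))
      simpa using h'
  have hW : ‖v (k + 1) - v₁‖ ^ 2 ≤ (1 - η k * σψ k / 2) * ‖v k - v₀‖ ^ 2 +
      3 * (η k * ((Lψyy2 k * ‖v₀‖ + LFy2) * ‖y k - y₀‖)) ^ 2 / (η k * σψ k) +
      6 * ((Lv1 k * ‖v₀‖ + Lv2 k) / σψ k ^ 2 * ‖x₁ - x₀‖) ^ 2 / (η k * σψ k) +
      6 * ((Cv1 * ‖v₁‖ + Cv2) * ‖grady F x₁ y₁‖ * ((μ k - μ (k + 1)) / μ k ^ 2)) ^ 2 /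
        (η k * σψ k) := by
    rcases subsingleton_or_nontrivial (Eu m) with hm | hm
    · rw [Subsingleton.elim (v (k + 1)) v₁, Subsingleton.elim (v k) v₀]
      simp only [sub_self, norm_zero, ne_eq, OfNat.ofNat_ne_zero, not_false_eq_true, zero_pow,
        mul_zero, zero_add]
      positivity
    · have hσL := strongConvex_le_lipschitz (hψ k) hψy (hψsc k)
      have hηL : η k * Lψ k ≤ 1 := (le_div_iff₀ (by linarith)).1 (hη k)
      have ht : η k * σψ k ≤ 1 := by nlinarith [hηpos k]
      have h := norm_multiplier_step_sub_le (hψ k) hψy hψyy hFy (hψsc k) (hηpos k).le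
        (by linarith) x₀ (y := y k) (v := v k) (hw k x₀)
      rw [← hv k] at h
      exact sq_le_of_contraction_of_drift ht₂ ht (norm_nonneg _)
        ((norm_sub_le_norm_sub_add_norm_sub (v (k + 1)) v₀ v₁).trans (add_le_add h hvdrift))
  rw [hV, hV, hαhat, hβhat, hηhat]
  exact lyapunov_sub_le (hηpos k) (hapos _).le (hbpos _).le (hcpos _).le (hadec k) (hbdec k)
    (hcdec k) (hF0 x₀ y₀) hΦ hΦ' hY hW
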